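/- arXiv:2412.11221 — 2 statements merged into one kernel-verified Lean document; each statement's English description precedes it below -/
import Mathlib

section
/- Let (X,d) be a compact metric space of diameter at most 1 and F : X → 2^X a continuous onto set-valued map with nonempty compact values. Then the following are equivalent: (a) F has the shadowing property; (b) for every ε > 0 there exist δ > 0 and N ∈ ℕ such that for every δ-pseudo-orbit (x_n) of F there exist points x_i^N ∈ F^N(x_i) with d(x_i^N, x_{i+N}) < ε/2 for all i, and the shifted sequence (x_{n+N})_{n∈ℕ} can be ε-shadowed by an F-orbit; (c) for every ε > 0 there exist δ > 0 and N ∈ ℕ such that for every δ-pseudo-orbit (x_n) of F there exist points x_i^N ∈ F^N(x_i) with d(x_i^N, x_{i+N}) < ε/2 for all i such that the sequence (x_n^N)_{n∈ℕ} can be ε-shadowed by an F-orbit. -/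
open Metric Set

variable {X : Type*} [MetricSpace X]

/-- A set-valued map `F : X → 2^X` is *upper semicontinuous* if for every `x` and every open
`U ⊇ F x` there is an open neighborhood `V` of `x` with `F y ⊆ U` for all `y ∈ V`. -/
def SVUpperSC (F : X → Set X) : Prop :=
  ∀ x : X, ∀ U : Set X, IsOpen U → F x ⊆ U →
    ∃ V : Set X, IsOpen V ∧ x ∈ V ∧ ∀ y ∈ V, F y ⊆ U

/-- A set-valued map is *lower semicontinuous* if for every `x` and every open `U` meeting
`F x` there is an open neighborhood `V` of `x` with `F y ∩ U ≠ ∅` for all `y ∈ V`. -/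
def SVLowerSC (F : X → Set X) : Prop :=
  ∀ x : X, ∀ U : Set X, IsOpen U → (F x ∩ U).Nonempty →
    ∃ V : Set X, IsOpen V ∧ x ∈ V ∧ ∀ y ∈ V, (F y ∩ U).Nonempty

/-- A set-valued map is *continuous* if it is both upper and lower semicontinuous. -/
def SVContinuous (F : X → Set X) : Prop := SVUpperSC F ∧ SVLowerSC F

/-- `F` has nonempty compact values. -/
def SVCompactValued (F : X → Set X) : Prop := ∀ x : X, (F x).Nonempty ∧ IsCompact (F x)

/-- Image of a set under a set-valued map: `F(U) = ⋃_{x ∈ U} F x`. -/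
def SVImage (F : X → Set X) (U : Set X) : Set X := ⋃ x ∈ U, F x

/-- A set-valued map is *open* if it maps open sets to open sets. -/
def SVOpen (F : X → Set X) : Prop := ∀ U : Set X, IsOpen U → IsOpen (SVImage F U)

/-- A set-valued map is *onto* if every point lies in some value. -/
def SVOnto (F : X → Set X) : Prop := ∀ y : X, ∃ x : X, y ∈ F x

/-- The inverse set-valued map `F⁻¹(x) = {z : x ∈ F z}`. -/
def SVInv (F : X → Set X) : X → Set X := fun x => {z | x ∈ F z}

/-- The orbit space `Orb_r(X) = {(x_n) : x_{n+1} ∈ F(x_n)}`. -/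
def OrbR (F : X → Set X) : Set (ℕ → X) := {u | ∀ n : ℕ, u (n + 1) ∈ F (u n)}

/-- The left orbit space `Orb_l(X) = {(…,x_{-1},x_0) : x_i ∈ F(x_{i+1})}`, encoded by
`u n = x_{-n}`, so the defining condition reads `u (n+1) ∈ F (u n)`. -/
def OrbL (F : X → Set X) : Set (ℕ → X) := {u | ∀ n : ℕ, u (n + 1) ∈ F (u n)}

/-- The inverse orbit space `Orb_inv(X) = {(x_n) : x_n ∈ F(x_{n+1})}`. -/
def OrbInv (F : X → Set X) : Set (ℕ → X) := {u | ∀ n : ℕ, u n ∈ F (u (n + 1))}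

/-- The shift on sequences. -/
def shiftSeq (u : ℕ → X) : ℕ → X := fun n => u (n + 1)

/-- The shift map `σ_rF : Orb_r(X) → Orb_r(X)`, `(x_n) ↦ (x_{n+1})`. -/
def sigmaR (F : X → Set X) : OrbR F → OrbR F :=
  fun u => ⟨shiftSeq u.1, fun n => u.2 (n + 1)⟩

/-- The shift map `σ_lF : Orb_l(X) → Orb_l(X)`, `(x_{-n}) ↦ (x_{-n-1})`, in the encoding
`u n = x_{-n}`. -/
def sigmaL (F : X → Set X) : OrbL F → OrbL F :=
  fun u => ⟨shiftSeq u.1, fun n => u.2 (n + 1)⟩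

/-- The metric `ρ((x_n),(y_n)) = Σ_{n≥0} d(x_n,y_n)/2^{n+1}` on sequence space. -/
noncomputable def rho (u v : ℕ → X) : ℝ := ∑' n : ℕ, dist (u n) (v n) / 2 ^ (n + 1)

/-- `ρ`-distance from a point to a set of sequences. -/
noncomputable def rhoInf (u : ℕ → X) (B : Set (ℕ → X)) : ℝ := sInf (rho u '' B)

/-- Hausdorff distance with respect to `ρ` between two sets of sequences. -/
noncomputable def rhoHaus (A B : Set (ℕ → X)) : ℝ :=
  max (sSup ((fun u => rhoInf u B) '' A)) (sSup ((fun v => rhoInf v A) '' B))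

/-- The shadowing property for a set-valued map: every `δ`-pseudo-orbit
(`d(x_{n+1}, F(x_n)) < δ`) is `ε`-shadowed by an `F`-orbit. -/
def SVShadowing (F : X → Set X) : Prop :=
  ∀ ε > (0 : ℝ), ∃ δ > (0 : ℝ), ∀ x : ℕ → X,
    (∀ n : ℕ, infDist (x (n + 1)) (F (x n)) < δ) →
    ∃ y : ℕ → X, (∀ n : ℕ, y (n + 1) ∈ F (y n)) ∧ ∀ n : ℕ, dist (x n) (y n) < ε

/-- The (single-valued) shadowing property for the shift `σ_rF` on `(Orb_r(X), ρ)`. -/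
def ShiftShadowingR (F : X → Set X) : Prop :=
  ∀ ε > (0 : ℝ), ∃ δ > (0 : ℝ), ∀ z : ℕ → (ℕ → X),
    (∀ n : ℕ, z n ∈ OrbR F) →
    (∀ n : ℕ, rho (shiftSeq (z n)) (z (n + 1)) < δ) →
    ∃ w ∈ OrbR F, ∀ n : ℕ, rho (shiftSeq^[n] w) (z n) < ε

/-- The (single-valued) shadowing property for the shift `σ_lF` on `(Orb_l(X), ρ)`. -/
def ShiftShadowingL (F : X → Set X) : Prop :=
  ∀ ε > (0 : ℝ), ∃ δ > (0 : ℝ), ∀ z : ℕ → (ℕ → X),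
    (∀ n : ℕ, z n ∈ OrbL F) →
    (∀ n : ℕ, rho (shiftSeq (z n)) (z (n + 1)) < δ) →
    ∃ w ∈ OrbL F, ∀ n : ℕ, rho (shiftSeq^[n] w) (z n) < ε

/-- `F` is expansive with expansive constant `δ`. -/
def SVExpansiveWith (F : X → Set X) (δ : ℝ) : Prop :=
  ∀ u ∈ OrbR F, ∀ v ∈ OrbR F, (∀ n : ℕ, dist (u n) (v n) < δ) → u 0 = v 0

/-- The shift `σ_rF` is expansive (as a single-valued map on `(Orb_r(X), ρ)`)
with expansive constant `c`. -/
def ShiftExpansiveWith (F : X → Set X) (c : ℝ) : Prop :=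
  ∀ u ∈ OrbR F, ∀ v ∈ OrbR F,
    (∀ k : ℕ, rho (shiftSeq^[k] u) (shiftSeq^[k] v) ≤ c) → u = v

/-- The induced set-valued map `F_inv` on `Orb_inv(X)`: `F_inv([x_n]) = F(x_0) × [x_n]`,
i.e. all sequences `(z, x_0, x_1, …)` with `z ∈ F(x_0)`. -/
def Finv (F : X → Set X) (u : ℕ → X) : Set (ℕ → X) :=
  {v | v 0 ∈ F (u 0) ∧ ∀ n : ℕ, v (n + 1) = u n}

/-- The shadowing property of `F_inv` as a set-valued map on `(Orb_inv(X), ρ)`. -/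
def FinvShadowing (F : X → Set X) : Prop :=
  ∀ ε > (0 : ℝ), ∃ δ > (0 : ℝ), ∀ x : ℕ → (ℕ → X),
    (∀ n : ℕ, x n ∈ OrbInv F) →
    (∀ n : ℕ, rhoInf (x (n + 1)) (Finv F (x n)) < δ) →
    ∃ y : ℕ → (ℕ → X), (∀ n : ℕ, y n ∈ OrbInv F) ∧
      (∀ n : ℕ, y (n + 1) ∈ Finv F (y n)) ∧ ∀ n : ℕ, rho (x n) (y n) < ε

/-- Iterates of a set-valued map: `F^0(x) = {x}`, `F^{k+1}(x) = ⋃_{z ∈ F^k(x)} F z`. -/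
def SVIter (F : X → Set X) : ℕ → X → Set X
  | 0 => fun x => {x}
  | n + 1 => fun x => SVImage F (SVIter F n x)

theorem SVIter_one {Y : Type*} (F : Y → Set Y) (x : Y) : SVIter F 1 x = F x := by
  simp [SVIter, SVImage]

/-- A pseudo-orbit of an onto map can be prolonged backwards by any number of steps. -/
theorem SVOnto.exists_backward_extension {F : X → Set X} (honto : SVOnto F) {δ : ℝ} (hδ : 0 < δ)
    (N : ℕ) (x : ℕ → X) (hx : ∀ n : ℕ, infDist (x (n + 1)) (F (x n)) < δ) :
    ∃ u : ℕ → X, (∀ n : ℕ, infDist (u (n + 1)) (F (u n)) < δ) ∧ ∀ n : ℕ, u (n + N) = x n := by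
  induction N with
  | zero => exact ⟨x, hx, fun _ => rfl⟩
  | succ N ih =>
    obtain ⟨u, hu, hux⟩ := ih
    obtain ⟨p, hp⟩ := honto (u 0)
    refine ⟨fun n => Nat.casesOn n p u, fun n => ?_, hux⟩
    cases n with
    | zero => exact (infDist_zero_of_mem hp).trans_lt hδ
    | succ n => exact hu n

/-- Under shadowing, the first iterate tracks every sufficiently fine pseudo-orbit, and both the
shifted pseudo-orbit and the tracking points are shadowed by one and the same orbit. -/
theorem SVShadowing.exists_iterate_one {F : X → Set X} (hFc : SVCompactValued F)
    (hS : SVShadowing F) {ε : ℝ} (hε : 0 < ε) :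
    ∃ δ > (0 : ℝ), ∀ x : ℕ → X, (∀ n : ℕ, infDist (x (n + 1)) (F (x n)) < δ) →
      ∃ z : ℕ → X, (∀ i : ℕ, z i ∈ SVIter F 1 (x i) ∧ dist (z i) (x (i + 1)) < ε / 2) ∧
        ∃ y : ℕ → X, (∀ n : ℕ, y (n + 1) ∈ F (y n)) ∧
          (∀ n : ℕ, dist (x (n + 1)) (y n) < ε) ∧ ∀ n : ℕ, dist (z n) (y n) < ε := by
  obtain ⟨δ, hδ, hshadow⟩ := hS (ε / 2) (half_pos hε)
  refine ⟨min δ (ε / 2), lt_min hδ (half_pos hε), fun x hx => ?_⟩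
  choose z hzF hz using fun i =>
    (infDist_lt_iff (hFc (x i)).1).1 ((hx i).trans_le (min_le_right δ (ε / 2)))
  obtain ⟨y, hy, hxy⟩ := hshadow x fun n => (hx n).trans_le (min_le_left _ _)
  refine ⟨z, fun i => ⟨(SVIter_one F (x i)).symm ▸ hzF i, dist_comm (x (i + 1)) (z i) ▸ hz i⟩,
    fun n => y (n + 1), fun n => hy (n + 1), fun n => ?_, fun n => ?_⟩
  · exact (hxy (n + 1)).trans (half_lt_self hε)
  · have h := dist_triangle_left (z n) (y (n + 1)) (x (n + 1))
    linarith [hz n, hxy (n + 1)]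

/-- For an onto map, shadowing of suitable forward shifts of pseudo-orbits implies shadowing. -/
theorem SVOnto.shadowing_of_shift {F : X → Set X} (honto : SVOnto F)
    (h : ∀ ε > (0 : ℝ), ∃ δ > (0 : ℝ), ∃ N : ℕ, ∀ x : ℕ → X,
      (∀ n : ℕ, infDist (x (n + 1)) (F (x n)) < δ) →
      ∃ y : ℕ → X, (∀ n : ℕ, y (n + 1) ∈ F (y n)) ∧ ∀ n : ℕ, dist (x (n + N)) (y n) < ε) :
    SVShadowing F := by
  intro ε hε
  obtain ⟨δ, hδ, N, hN⟩ := h ε hε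
  refine ⟨δ, hδ, fun x hx => ?_⟩
  obtain ⟨u, hu, hux⟩ := honto.exists_backward_extension hδ N x hx
  obtain ⟨y, hy, huy⟩ := hN u hu
  exact ⟨y, hy, fun n => hux n ▸ huy n⟩


/-- For a continuous onto set-valued map `F` with nonempty compact values
on a compact metric space of diameter at most 1, the following are equivalent:
(a) `F` has the shadowing property;
(b) for every `ε > 0` there exist `δ > 0` and `N ∈ ℕ` such that for every `δ`-pseudo-orbit
`(x_n)` there exist `x_i^N ∈ F^N(x_i)` with `d(x_i^N, x_{i+N}) < ε/2` for all `i`, and the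
shifted sequence `(x_{n+N})` can be `ε`-shadowed by an `F`-orbit;
(c) for every `ε > 0` there exist `δ > 0` and `N ∈ ℕ` such that for every `δ`-pseudo-orbit
`(x_n)` there exist `x_i^N ∈ F^N(x_i)` with `d(x_i^N, x_{i+N}) < ε/2` for all `i` such that
the sequence `(x_n^N)` can be `ε`-shadowed by an `F`-orbit. -/
theorem svShadowing_tfae_iterated [CompactSpace X]
    (hdiam : diam (univ : Set X) ≤ 1)
    (F : X → Set X) (hF : SVContinuous F) (hFc : SVCompactValued F) (honto : SVOnto F) :
    (SVShadowing F ↔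
      (∀ ε > (0 : ℝ), ∃ δ > (0 : ℝ), ∃ N : ℕ, ∀ x : ℕ → X,
        (∀ n : ℕ, infDist (x (n + 1)) (F (x n)) < δ) →
        (∀ i : ℕ, ∃ z ∈ SVIter F N (x i), dist z (x (i + N)) < ε / 2) ∧
        ∃ y : ℕ → X, (∀ n : ℕ, y (n + 1) ∈ F (y n)) ∧
          ∀ n : ℕ, dist (x (n + N)) (y n) < ε)) ∧
    (SVShadowing F ↔
      (∀ ε > (0 : ℝ), ∃ δ > (0 : ℝ), ∃ N : ℕ, ∀ x : ℕ → X,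
        (∀ n : ℕ, infDist (x (n + 1)) (F (x n)) < δ) →
        ∃ xN : ℕ → X, (∀ i : ℕ, xN i ∈ SVIter F N (x i) ∧ dist (xN i) (x (i + N)) < ε / 2) ∧
        ∃ y : ℕ → X, (∀ n : ℕ, y (n + 1) ∈ F (y n)) ∧
          ∀ n : ℕ, dist (xN n) (y n) < ε)) := by
  refine ⟨⟨fun hS ε hε => ?_, fun h => honto.shadowing_of_shift fun ε hε => ?_⟩,
    ⟨fun hS ε hε => ?_, fun h => honto.shadowing_of_shift fun ε hε => ?_⟩⟩
  · obtain ⟨δ, hδ, hx⟩ := hS.exists_iterate_one hFc hε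
    refine ⟨δ, hδ, 1, fun x hxδ => ?_⟩
    obtain ⟨z, hz, y, hy, hxy, -⟩ := hx x hxδ
    exact ⟨fun i => ⟨z i, hz i⟩, y, hy, hxy⟩
  · obtain ⟨δ, hδ, N, hN⟩ := h ε hε
    exact ⟨δ, hδ, N, fun x hx => (hN x hx).2⟩
  · obtain ⟨δ, hδ, hx⟩ := hS.exists_iterate_one hFc hε
    refine ⟨δ, hδ, 1, fun x hxδ => ?_⟩
    obtain ⟨z, hz, y, hy, -, hzy⟩ := hx x hxδ
    exact ⟨z, hz, y, hy, hzy⟩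
  · obtain ⟨δ, hδ, N, hN⟩ := h (ε / 2) (half_pos hε)
    refine ⟨δ, hδ, N, fun x hx => ?_⟩
    obtain ⟨z, hz, y, hy, hzy⟩ := hN x hx
    refine ⟨y, hy, fun n => ?_⟩
    have h := dist_triangle_left (x (n + N)) (y n) (z n)
    linarith [(hz n).2, hzy n]
end

section
/- Let (X,d) be a compact metric space of diameter at most 1 and F : X → 2^X a continuous onto set-valued map with nonempty compact values. Then F has the shadowing property if and only if the induced inverse set-valued map F_inv on Orb_inv(X) has the shadowing property (as a set-valued map on the compact metric space (Orb_inv(X), ρ)). -/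
open Metric Set

variable {X : Type*} [MetricSpace X]

theorem dist_le_one_of_diam_univ_le_one [CompactSpace X] (hdiam : diam (univ : Set X) ≤ 1)
    (a b : X) : dist a b ≤ 1 :=
  (dist_le_diam_of_mem isCompact_univ.isBounded (mem_univ a) (mem_univ b)).trans hdiam

section Rho

theorem summable_rho (hd : ∀ a b : X, dist a b ≤ 1) (u v : ℕ → X) :
    Summable fun n : ℕ => dist (u n) (v n) / 2 ^ (n + 1) := by
  refine Summable.of_nonneg_of_le (fun n => by positivity) (fun n => ?_) summable_geometric_two
  rw [one_div, inv_pow, ← one_div]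
  refine div_le_div₀ zero_le_one (hd _ _) (by positivity) ?_
  exact pow_le_pow_right₀ one_le_two n.le_succ

theorem rho_nonneg (u v : ℕ → X) : 0 ≤ rho u v :=
  tsum_nonneg fun n => by positivity

theorem rho_eq_head_add_tail (hd : ∀ a b : X, dist a b ≤ 1) (u v : ℕ → X) :
    rho u v = dist (u 0) (v 0) / 2 + rho (shiftSeq u) (shiftSeq v) / 2 := by
  unfold rho
  rw [(summable_rho hd u v).tsum_eq_zero_add, ← tsum_div_const]
  congr 1
  · simp
  · refine tsum_congr fun n => ?_
    simp only [shiftSeq]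
    rw [pow_succ (2 : ℝ) (n + 1), div_div]

theorem dist_le_two_pow_mul_rho (hd : ∀ a b : X, dist a b ≤ 1) (u v : ℕ → X) (k : ℕ) :
    dist (u k) (v k) ≤ 2 ^ (k + 1) * rho u v := by
  have h := (summable_rho hd u v).le_tsum k fun n _ => by positivity
  rwa [div_le_iff₀' (by positivity)] at h

theorem rho_le_one (hd : ∀ a b : X, dist a b ≤ 1) (u v : ℕ → X) : rho u v ≤ 1 := by
  refine (Summable.tsum_le_tsum (fun n => ?_) (summable_rho hd u v)
    (summable_geometric_two' 1)).trans (tsum_geometric_two' 1).le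
  rw [pow_succ', ← div_div]
  have := hd (u n) (v n)
  gcongr

/-- Sequences that are `η`-close on the first `N` coordinates are `ρ`-close up to `2⁻ᴺ`. -/
theorem rho_le_add_pow (hd : ∀ a b : X, dist a b ≤ 1) {η : ℝ} (hη : 0 ≤ η) (N : ℕ) :
    ∀ u v : ℕ → X, (∀ k < N, dist (u k) (v k) ≤ η) → rho u v ≤ η + (1 / 2) ^ N := by
  induction N with
  | zero =>
    intro u v _
    have := rho_le_one hd u v
    simp only [pow_zero]
    linarith
  | succ N ih =>
    intro u v h
    have h0 := h 0 N.succ_pos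
    have ht := ih (shiftSeq u) (shiftSeq v) fun k hk => h (k + 1) (Nat.succ_lt_succ hk)
    rw [rho_eq_head_add_tail hd, pow_succ]
    linarith

theorem exists_rho_lt_of_rhoInf_lt {u : ℕ → X} {B : Set (ℕ → X)} {δ : ℝ} (hB : B.Nonempty)
    (h : rhoInf u B < δ) : ∃ v ∈ B, rho u v < δ := by
  obtain ⟨_, ⟨v, hv, rfl⟩, hlt⟩ := exists_lt_of_csInf_lt (hB.image _) h
  exact ⟨v, hv, hlt⟩

theorem rhoInf_le_rho {u v : ℕ → X} {B : Set (ℕ → X)} (hv : v ∈ B) : rhoInf u B ≤ rho u v := by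
  refine csInf_le ⟨0, ?_⟩ (mem_image_of_mem _ hv)
  rintro _ ⟨w, _, rfl⟩
  exact rho_nonneg u w

end Rho

section UniformContinuity

variable {F : X → Set X}

theorem SVUpperSC.exists_nhds_dist_lt (hF : SVUpperSC F) (x : X) {η : ℝ} (hη : 0 < η) :
    ∃ V : Set X, IsOpen V ∧ x ∈ V ∧ ∀ y ∈ V, ∀ a ∈ F y, ∃ b ∈ F x, dist a b < η := by
  obtain ⟨V, hV, hxV, h⟩ := hF x _ isOpen_thickening (self_subset_thickening hη (F x))
  exact ⟨V, hV, hxV, fun y hy a ha => mem_thickening_iff.1 (h y hy ha)⟩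

theorem SVLowerSC.exists_nhds_dist_lt (hF : SVLowerSC F) {x : X} (hx : IsCompact (F x))
    {η : ℝ} (hη : 0 < η) :
    ∃ V : Set X, IsOpen V ∧ x ∈ V ∧ ∀ y ∈ V, ∀ a ∈ F x, ∃ b ∈ F y, dist a b < η := by
  obtain ⟨t, htF, htfin, hcov⟩ := hx.finite_cover_balls (half_pos hη)
  have hloc : ∀ c ∈ t, ∃ V : Set X, IsOpen V ∧ x ∈ V ∧
      ∀ y ∈ V, (F y ∩ ball c (η / 2)).Nonempty := fun c hc =>
    hF x _ isOpen_ball ⟨c, htF hc, mem_ball_self (half_pos hη)⟩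
  choose! V hVo hxV hV using hloc
  refine ⟨⋂ c ∈ t, V c, htfin.isOpen_biInter hVo, mem_iInter₂.2 hxV, fun y hy a ha => ?_⟩
  obtain ⟨c, hc, hac⟩ := mem_iUnion₂.1 (hcov ha)
  obtain ⟨b, hb, hbc⟩ := hV c hc y (mem_iInter₂.1 hy c hc)
  refine ⟨b, hb, ?_⟩
  rw [mem_ball] at hac hbc
  linarith [dist_triangle_right a b c]

/-- On a compact space, a continuous compact-valued map is uniformly continuous. -/
theorem SVContinuous.uniform [CompactSpace X] (hF : SVContinuous F) (hFc : SVCompactValued F)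
    {η : ℝ} (hη : 0 < η) :
    ∃ γ > 0, ∀ x y : X, dist x y < γ → ∀ a ∈ F x, ∃ b ∈ F y, dist a b < η := by
  have hloc : ∀ c : X, ∃ V : Set X, IsOpen V ∧ c ∈ V ∧
      (∀ y ∈ V, ∀ a ∈ F y, ∃ b ∈ F c, dist a b < η / 2) ∧
      ∀ y ∈ V, ∀ a ∈ F c, ∃ b ∈ F y, dist a b < η / 2 := by
    intro c
    obtain ⟨V, hVo, hcV, hV⟩ := hF.1.exists_nhds_dist_lt c (half_pos hη)
    obtain ⟨W, hWo, hcW, hW⟩ := hF.2.exists_nhds_dist_lt (hFc c).2 (half_pos hη)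
    exact ⟨V ∩ W, hVo.inter hWo, ⟨hcV, hcW⟩, fun y hy => hV y hy.1, fun y hy => hW y hy.2⟩
  choose V hVo hcV hup hlow using hloc
  obtain ⟨γ, hγ, hleb⟩ := lebesgue_number_lemma_of_metric isCompact_univ hVo
    fun x _ => mem_iUnion.2 ⟨x, hcV x⟩
  refine ⟨γ, hγ, fun x y hxy a ha => ?_⟩
  obtain ⟨c, hc⟩ := hleb x (mem_univ x)
  obtain ⟨b, hb, hab⟩ := hup c x (hc (mem_ball_self hγ)) a ha
  obtain ⟨e, he, hbe⟩ := hlow c y (hc (mem_ball'.2 hxy)) b hb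
  exact ⟨e, he, by linarith [dist_triangle a b e]⟩

/-- Finite segments of pseudo-orbits are traced by orbit segments. -/
theorem SVContinuous.finite_tracing [CompactSpace X] (hF : SVContinuous F)
    (hFc : SVCompactValued F) (N : ℕ) :
    ∀ η > (0 : ℝ), ∃ δ > (0 : ℝ), ∀ s : ℕ → X,
      (∀ n, infDist (s (n + 1)) (F (s n)) < δ) →
      ∃ w : ℕ → X, (∀ n < N, w (n + 1) ∈ F (w n)) ∧ ∀ n ≤ N, dist (s n) (w n) < η := by
  induction N with
  | zero =>
    intro η hη
    exact ⟨1, one_pos, fun s _ => ⟨s, fun n hn => absurd hn n.not_lt_zero,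
      fun n _ => by rwa [dist_self]⟩⟩
  | succ N ih =>
    intro η hη
    obtain ⟨γ, hγ, hunif⟩ := hF.uniform hFc (half_pos hη)
    obtain ⟨δ, hδ, htr⟩ := ih (min η γ) (lt_min hη hγ)
    refine ⟨min δ (η / 2), lt_min hδ (half_pos hη), fun s hs => ?_⟩
    obtain ⟨w, hw, hsw⟩ := htr s fun n => (hs n).trans_le (min_le_left _ _)
    obtain ⟨a, ha, hsa⟩ :=
      (infDist_lt_iff (hFc (s N)).1).1 ((hs N).trans_le (min_le_right _ _))
    obtain ⟨b, hb, hab⟩ := hunif _ _ ((hsw N le_rfl).trans_le (min_le_right _ _)) a ha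
    refine ⟨Function.update w (N + 1) b, fun n hn => ?_, fun n hn => ?_⟩
    · rw [Function.update_of_ne (by omega : n ≠ N + 1)]
      rcases (Nat.lt_succ_iff_lt_or_eq.1 hn) with h | rfl
      · rw [Function.update_of_ne (by omega : n + 1 ≠ N + 1)]
        exact hw n h
      · rwa [Function.update_self]
    · rcases hn.lt_or_eq with h | rfl
      · rw [Function.update_of_ne h.ne]
        exact (hsw n (Nat.lt_succ_iff.1 h)).trans_le (min_le_left _ _)
      · rw [Function.update_self]
        linarith [dist_triangle (s (N + 1)) a b]

end UniformContinuity

section Sequences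

variable {F : X → Set X}

/-- The sequence `(w M, w (M - 1), …, w 0, p (w 0), p (p (w 0)), …)`. -/
def backwardSeq (p : X → X) (w : ℕ → X) (M : ℕ) : ℕ → X :=
  fun k => if k ≤ M then w (M - k) else p^[k - M] (w 0)

theorem backwardSeq_of_le {α : Type*} (p : α → α) (w : ℕ → α) {M k : ℕ} (h : k ≤ M) :
    backwardSeq p w M k = w (M - k) := if_pos h

theorem backwardSeq_succ_succ {α : Type*} (p : α → α) (w : ℕ → α) (M k : ℕ) :
    backwardSeq p w (M + 1) (k + 1) = backwardSeq p w M k := by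
  simp [backwardSeq]

theorem backwardSeq_mem_OrbInv {α : Type*} {F : α → Set α} {p : α → α}
    (hp : ∀ y, y ∈ F (p y)) {w : ℕ → α} {M : ℕ} (hw : ∀ n < M, w (n + 1) ∈ F (w n)) : backwardSeq p w M ∈ OrbInv F := by
  intro k
  rcases lt_trichotomy k M with h | rfl | h
  · rw [backwardSeq_of_le p w h.le, backwardSeq_of_le p w h]
    have := hw (M - (k + 1)) (by omega)
    rwa [show M - (k + 1) + 1 = M - k by omega] at this
  · simpa [backwardSeq] using hp (w 0)
  · simp only [backwardSeq, if_neg h.not_ge, if_neg (h.trans k.lt_succ_self).not_ge]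
    rw [Nat.succ_sub h.le, Function.iterate_succ_apply']
    exact hp _

/-- The sequence `(a N, a (N - 1), …, a 0, x 1, x 2, …)`. -/
def prependSeq (a x : ℕ → X) (N : ℕ) : ℕ → X :=
  fun m => if m ≤ N then a (N - m) else x (m - N)

theorem prependSeq_sub {α : Type*} (a x : ℕ → α) {N k : ℕ} (h : k ≤ N) :
    prependSeq a x N (N - k) = a k := by
  rw [prependSeq, if_pos (N.sub_le k), Nat.sub_sub_self h]

theorem prependSeq_add {α : Type*} {a x : ℕ → α} (h : a 0 = x 0) (N n : ℕ) :
    prependSeq a x N (N + n) = x n := by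
  rcases n.eq_zero_or_pos with rfl | hn
  · simp [prependSeq, h]
  · rw [prependSeq, if_neg (by omega), Nat.add_sub_cancel_left]

theorem prependSeq_infDist_lt {a x : ℕ → X} {δ : ℝ} (hδ : 0 < δ) (ha : a ∈ OrbInv F)
    (h : a 0 = x 0) (hx : ∀ n, infDist (x (n + 1)) (F (x n)) < δ) (N m : ℕ) :
    infDist (prependSeq a x N (m + 1)) (F (prependSeq a x N m)) < δ := by
  rcases lt_or_ge m N with hm | hm
  · obtain ⟨k, rfl⟩ : ∃ k, N = m + 1 + k := ⟨N - (m + 1), by omega⟩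
    have h1 := prependSeq_sub a x (show k ≤ m + 1 + k by omega)
    have h2 := prependSeq_sub a x (show k + 1 ≤ m + 1 + k by omega)
    rw [show m + 1 + k - k = m + 1 by omega] at h1
    rw [show m + 1 + k - (k + 1) = m by omega] at h2
    rwa [h1, h2, infDist_zero_of_mem (ha k)]
  · obtain ⟨n, rfl⟩ := Nat.exists_eq_add_of_le hm
    rw [add_assoc, prependSeq_add h, prependSeq_add h]
    exact hx n

end Sequences

theorem SVShadowing.finvShadowing {F : X → Set X} (hd : ∀ a b : X, dist a b ≤ 1)
    (hFc : SVCompactValued F) (honto : SVOnto F) (hsh : SVShadowing F) : FinvShadowing F := by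
  choose p hp using honto
  intro ε hε
  obtain ⟨N, hN⟩ := exists_pow_lt_of_lt_one (half_pos hε) (one_half_lt_one (α := ℝ))
  obtain ⟨δ₀, hδ₀, hshad⟩ := hsh (ε / 4) (by positivity)
  set c : ℝ := ε / 4 / (N + 1) with hc
  have hcpos : 0 < c := by positivity
  refine ⟨min (δ₀ / 2) (c / 2 ^ (N + 1)), by positivity, fun x hx hpo => ?_⟩
  have hstep : ∀ n, ∃ v ∈ Finv F (x n), rho (x (n + 1)) v < min (δ₀ / 2) (c / 2 ^ (N + 1)) := by
    intro n
    obtain ⟨a, ha⟩ := (hFc (x n 0)).1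
    exact exists_rho_lt_of_rhoInf_lt ⟨fun k => Nat.casesOn k a (x n), ha, fun _ => rfl⟩ (hpo n)
  have hhead : ∀ n, infDist (x (n + 1) 0) (F (x n 0)) < δ₀ := by
    intro n
    obtain ⟨v, hv, hlt⟩ := hstep n
    have h1 := dist_le_two_pow_mul_rho hd (x (n + 1)) v 0
    have h2 := hlt.trans_le (min_le_left _ _)
    have h3 := infDist_le_dist_of_mem (x := x (n + 1) 0) hv.1
    simp only [zero_add, pow_one] at h1
    linarith
  have hshift : ∀ n, ∀ k < N, dist (x (n + 1) (k + 1)) (x n k) ≤ c := by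
    intro n k hk
    obtain ⟨v, hv, hlt⟩ := hstep n
    have h1 := dist_le_two_pow_mul_rho hd (x (n + 1)) v (k + 1)
    rw [hv.2 k] at h1
    have h2 : rho (x (n + 1)) v < c / 2 ^ (N + 1) := hlt.trans_le (min_le_right _ _)
    rw [lt_div_iff₀' (by positivity)] at h2
    have h3 : (2 : ℝ) ^ (k + 1 + 1) ≤ 2 ^ (N + 1) :=
      pow_le_pow_right₀ one_le_two (by omega)
    have h4 := mul_le_mul_of_nonneg_right h3 (rho_nonneg (x (n + 1)) v)
    linarith
  set s := prependSeq (x 0) (fun n => x n 0) N with hs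
  have hclose : ∀ n, ∀ k ≤ N, dist (x n k) (s (N + n - k)) ≤ k * c := by
    intro n
    induction n with
    | zero =>
      intro k hk
      rw [add_zero, hs, prependSeq_sub _ _ hk, dist_self]
      positivity
    | succ n ih =>
      rintro (_ | k) hk
      · rw [Nat.sub_zero, hs, prependSeq_add (x := fun n => x n 0) rfl]
        simp
      · have h1 := hshift n k hk
        have h2 := ih k (by omega)
        rw [show N + (n + 1) - (k + 1) = N + n - k by omega]
        push_cast
        linarith [dist_triangle (x (n + 1) (k + 1)) (x n k) (s (N + n - k))]
  obtain ⟨w, hw, hsw⟩ := hshad s (prependSeq_infDist_lt (x := fun n => x n 0) hδ₀ (hx 0) rfl hhead N)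
  refine ⟨fun n => backwardSeq p w (N + n), fun n => backwardSeq_mem_OrbInv hp fun m _ => hw m,
    fun n => ⟨?_, fun k => backwardSeq_succ_succ p w (N + n) k⟩, fun n => ?_⟩
  · beta_reduce
    rw [backwardSeq_of_le _ _ (Nat.zero_le _), backwardSeq_of_le _ _ (Nat.zero_le _)]
    exact hw (N + n)
  · have hrho := rho_le_add_pow hd (half_pos hε).le N (x n) (backwardSeq p w (N + n)) ?_
    · linarith
    intro k hk
    rw [backwardSeq_of_le _ _ (by omega)]
    have h1 := hclose n k hk.le
    have h2 := hsw (N + n - k)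
    have h3 : (k : ℝ) * c ≤ ε / 4 := by
      have hkN : (k : ℝ) ≤ N + 1 := by exact_mod_cast hk.le.trans N.le_succ
      calc (k : ℝ) * c ≤ (N + 1) * c := by gcongr
        _ = ε / 4 := by rw [hc]; field_simp
    linarith [dist_triangle (x n k) (s (N + n - k)) (w (N + n - k))]

theorem FinvShadowing.svShadowing [CompactSpace X] {F : X → Set X}
    (hd : ∀ a b : X, dist a b ≤ 1) (hF : SVContinuous F) (hFc : SVCompactValued F)
    (honto : SVOnto F) (hsh : FinvShadowing F) : SVShadowing F := by
  choose p hp using honto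
  intro ε hε
  obtain ⟨δ, hδ, hshad⟩ := hsh (ε / 4) (by positivity)
  obtain ⟨N, hN⟩ := exists_pow_lt_of_lt_one (half_pos hδ) (one_half_lt_one (α := ℝ))
  obtain ⟨γ, hγ, hunif⟩ := hF.uniform hFc (show 0 < δ / 8 by positivity)
  obtain ⟨η, hη, hηγ, hηδ, hηε⟩ : ∃ η > 0, η ≤ γ ∧ η ≤ δ / 8 ∧ η ≤ ε / 2 :=
    ⟨min γ (min (δ / 8) (ε / 2)), by positivity, min_le_left _ _,
      (min_le_right _ _).trans (min_le_left _ _), (min_le_right _ _).trans (min_le_right _ _)⟩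
  obtain ⟨δ₀, hδ₀, htr⟩ := hF.finite_tracing hFc N η hη
  have hδ₁ : 0 < min δ₀ (δ / 8) := by positivity
  refine ⟨min δ₀ (δ / 8), hδ₁, fun x hx => ?_⟩
  have hback : backwardSeq p x 0 ∈ OrbInv F :=
    backwardSeq_mem_OrbInv hp fun n hn => absurd hn n.not_lt_zero
  have hback0 : backwardSeq p x 0 0 = x 0 := backwardSeq_of_le p x le_rfl
  set s := prependSeq (backwardSeq p x 0) x N with hs
  have hspo : ∀ m, infDist (s (m + 1)) (F (s m)) < min δ₀ (δ / 8) :=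
    prependSeq_infDist_lt hδ₁ hback hback0 hx N
  have hsx : ∀ n, s (n + N) = x n := fun n => by rw [add_comm]; exact prependSeq_add hback0 N n
  choose w hw hsw using fun n => htr (fun m => s (n + m)) fun m =>
    (hspo (n + m)).trans_le (min_le_left _ _)
  set z : ℕ → ℕ → X := fun n => backwardSeq p (w n) N with hz
  have hzs : ∀ n, ∀ k ≤ N, dist (z n k) (s (n + (N - k))) < η := by
    intro n k hk
    rw [dist_comm, hz]
    simp only [backwardSeq_of_le p (w n) hk]
    exact hsw n (N - k) (N.sub_le k)
  have hzx : ∀ n, dist (z n 0) (x n) < η := fun n => by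
    simpa [hsx] using hzs n 0 N.zero_le
  obtain ⟨y, -, hyF, hzy⟩ := hshad z (fun n => backwardSeq_mem_OrbInv hp (hw n)) fun n => by
    obtain ⟨a, ha, hxa⟩ := (infDist_lt_iff (hFc (x n)).1).1 ((hx n).trans_le (min_le_right _ _))
    obtain ⟨b, hb, hab⟩ := hunif (x n) (z n 0)
      (by rw [dist_comm]; exact (hzx n).trans_le hηγ) a ha
    set v : ℕ → X := fun k => Nat.casesOn k b (z n) with hv
    have hvF : v ∈ Finv F (z n) := ⟨hb, fun _ => rfl⟩
    have hrho := rho_le_add_pow hd (show 0 ≤ 3 * δ / 8 by positivity) N (z (n + 1)) v ?_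
    · linarith [rhoInf_le_rho (u := z (n + 1)) hvF]
    rintro (_ | k) hk
    · have h1 := hzx (n + 1)
      have h2 := dist_triangle4 (z (n + 1) 0) (x (n + 1)) a b
      change dist (z (n + 1) 0) b ≤ _
      linarith
    · have h1 := hzs (n + 1) (k + 1) hk.le
      have h2 := hzs n k (by omega)
      rw [show n + 1 + (N - (k + 1)) = n + (N - k) by omega] at h1
      change dist (z (n + 1) (k + 1)) (z n k) ≤ _
      linarith [dist_triangle_right (z (n + 1) (k + 1)) (z n k) (s (n + (N - k)))]
  refine ⟨fun n => y n 0, fun n => (hyF n).1, fun n => ?_⟩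
  have h1 := dist_le_two_pow_mul_rho hd (z n) (y n) 0
  have h2 := dist_triangle_left (x n) (y n 0) (z n 0)
  simp only [zero_add, pow_one] at h1
  linarith [hzx n, hzy n]

/-- For a continuous onto set-valued map `F` with nonempty compact values
on a compact metric space of diameter at most 1, `F` has the shadowing property iff the
induced inverse set-valued map `F_inv` on `(Orb_inv(X), ρ)` has the shadowing property. -/
theorem svShadowing_iff_finvShadowing [CompactSpace X]
    (hdiam : diam (univ : Set X) ≤ 1)
    (F : X → Set X) (hF : SVContinuous F) (hFc : SVCompactValued F) (honto : SVOnto F) :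
    SVShadowing F ↔ FinvShadowing F := by
  have hd := dist_le_one_of_diam_univ_le_one hdiam
  exact ⟨fun h => h.finvShadowing hd hFc honto, fun h => h.svShadowing hd hF hFc honto⟩
end
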